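/- Let ι be a nonempty finite index set, g : ι → ℝ, and τ > 0, and let Q⋆(i) = exp(−g(i)/τ) / Σ_j exp(−g(j)/τ) be the Gibbs distribution. Then the minimum of F(q) = Σ_i q(i)·g(i) + τ·Σ_i q(i)·log(q(i)·|ι|) over the probability simplex, attained at Q⋆, equals −τ·log( (1/|ι|) · Σ_i exp(−g(i)/τ) ). Equivalently, for every q in the simplex, Σ_i q(i)·g(i) + τ·Σ_i q(i)·log(q(i)·|ι|) ≥ −τ·log( (1/|ι|) · Σ_i exp(−g(i)/τ) ). -/

import Mathlib

/-- The probability simplex over a finite index set `ι`. -/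
def probSimplex (ι : Type*) [Fintype ι] : Set (ι → ℝ) :=
  {q | (∀ i, 0 ≤ q i) ∧ ∑ i, q i = 1}

/-- The free-energy functional `F(q) = Σ q(i) g(i) + τ Σ q(i) log(q(i)·|ι|)`
(the convention `0 · log 0 = 0` is automatic since `Real.log 0 = 0`). -/
noncomputable def freeEnergy {ι : Type*} [Fintype ι] (g : ι → ℝ) (τ : ℝ) (q : ι → ℝ) : ℝ :=
  ∑ i, q i * g i + τ * ∑ i, q i * Real.log (q i * (Fintype.card ι : ℝ))

/-- The Gibbs distribution for energy `g` and temperature `τ`. -/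
noncomputable def gibbs {ι : Type*} [Fintype ι] (g : ι → ℝ) (τ : ℝ) (i : ι) : ℝ :=
  Real.exp (-(g i) / τ) / ∑ j, Real.exp (-(g j) / τ)

theorem stmt3 {ι : Type*} [Fintype ι] [Nonempty ι] (g : ι → ℝ) (τ : ℝ) (hτ : 0 < τ) :
    freeEnergy g τ (gibbs g τ)
        = -τ * Real.log ((1 / (Fintype.card ι : ℝ)) * ∑ i, Real.exp (-(g i) / τ)) ∧
      ∀ q ∈ probSimplex ι,
        freeEnergy g τ q
          ≥ -τ * Real.log ((1 / (Fintype.card ι : ℝ)) * ∑ i, Real.exp (-(g i) / τ)) := by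
  have hn : (0 : ℝ) < (Fintype.card ι : ℝ) := by exact_mod_cast Fintype.card_pos
  have hZ : 0 < ∑ j, Real.exp (-(g j) / τ) :=
    Finset.sum_pos (fun j _ => Real.exp_pos _) Finset.univ_nonempty
  have hL : Real.log ((1 / (Fintype.card ι : ℝ)) * ∑ i, Real.exp (-(g i) / τ))
      = Real.log (∑ i, Real.exp (-(g i) / τ)) - Real.log (Fintype.card ι : ℝ) := by
    rw [one_div_mul_eq_div, Real.log_div hZ.ne' hn.ne']
  have hp : ∀ i, 0 < gibbs g τ i := fun i => div_pos (Real.exp_pos _) hZ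
  have hlogp : ∀ i, Real.log (gibbs g τ i)
      = -(g i) / τ - Real.log (∑ i, Real.exp (-(g i) / τ)) := by
    intro i
    unfold gibbs
    rw [Real.log_div (Real.exp_pos _).ne' hZ.ne', Real.log_exp]
  have hsum : ∑ i, gibbs g τ i = 1 := by
    unfold gibbs
    rw [← Finset.sum_div, div_self hZ.ne']
  rw [hL]
  set L := Real.log (∑ i, Real.exp (-(g i) / τ)) with hLdef
  constructor
  · have key : ∀ i, gibbs g τ i * g i
        + τ * (gibbs g τ i * Real.log (gibbs g τ i * (Fintype.card ι : ℝ)))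
        = gibbs g τ i * (-τ * (L - Real.log (Fintype.card ι : ℝ))) := by
      intro i
      rw [Real.log_mul (hp i).ne' hn.ne', hlogp i]
      field_simp
      ring
    unfold freeEnergy
    rw [Finset.mul_sum, ← Finset.sum_add_distrib, Finset.sum_congr rfl (fun i _ => key i),
      ← Finset.sum_mul, hsum, one_mul]
  · rintro q ⟨hq0, hq1⟩
    have key : ∀ i, q i * (-τ * (L - Real.log (Fintype.card ι : ℝ))) + τ * (q i - gibbs g τ i)
        ≤ q i * g i + τ * (q i * Real.log (q i * (Fintype.card ι : ℝ))) := by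
      intro i
      rcases (hq0 i).eq_or_lt with h | h
      · rw [← h]
        have := mul_pos hτ (hp i)
        simp only [zero_mul, mul_zero, zero_add, zero_sub]
        linarith
      · have h1 := Real.log_le_sub_one_of_pos (div_pos (hp i) h)
        rw [Real.log_div (hp i).ne' h.ne', hlogp i] at h1
        rw [Real.log_mul h.ne' hn.ne']
        have h2 := mul_le_mul_of_nonneg_left h1 (mul_pos hτ h).le
        have e1 : τ * q i * (gibbs g τ i / q i - 1) = τ * (gibbs g τ i - q i) := by
          field_simp
        have e2 : τ * q i * (-(g i) / τ - L - Real.log (q i))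
            = - (q i * g i) - τ * q i * L - τ * q i * Real.log (q i) := by
          field_simp
        rw [e1, e2] at h2
        linarith
    have h3 := Finset.sum_le_sum (fun i (_ : i ∈ Finset.univ) => key i)
    rw [Finset.sum_add_distrib, ← Finset.sum_mul, ← Finset.mul_sum, Finset.sum_sub_distrib,
      hq1, hsum, Finset.sum_add_distrib, ← Finset.mul_sum] at h3
    unfold freeEnergy
    linarith
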